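/- arXiv:2407.03101 — 4 statements merged into one kernel-verified Lean document; each statement's English description precedes it below -/
import Mathlib

section
/- Let G be a finite directed graph with edge weights w : E(G) → ℝ that are pairwise distinct, and let s, t be vertices such that at least one directed path from s to t exists. Then there exists exactly one retractable simple directed path from s to t. -/
open Set

variable {V : Type*}

/-- `l` is a directed path (a nonempty list of vertices, consecutive ones joined by edges
of `Adj`) from `s` to `t`. -/
def IsDiPath (Adj : V → V → Prop) (s t : V) (l : List V) : Prop :=
  l.head? = some s ∧ l.getLast? = some t ∧ l.Chain' Adj

/-- The bottleneck of a path: the maximum weight of an edge on it. -/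
noncomputable def bottleneck (w : V → V → ℝ) (l : List V) : ℝ :=
  sSup ((fun e : V × V => w e.1 e.2) '' { e | e ∈ l.zip l.tail })

/-- The bottleneck distance from `s` to `t`: the minimum bottleneck of a simple directed
path from `s` to `t`. -/
noncomputable def dBot (Adj : V → V → Prop) (w : V → V → ℝ) (s t : V) : ℝ :=
  sInf { r | ∃ l, IsDiPath Adj s t l ∧ l.Nodup ∧ r = bottleneck w l }

/-- `e` is the bottleneck edge of `s` and `t`: the edge of weight `dBot Adj w s t` lying on
a bottleneck-optimal simple path from `s` to `t`. -/
def IsBtlEdge (Adj : V → V → Prop) (w : V → V → ℝ) (s t : V) (e : V × V) : Prop :=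
  ∃ l, IsDiPath Adj s t l ∧ l.Nodup ∧ bottleneck w l = dBot Adj w s t ∧
    e ∈ l.zip l.tail ∧ w e.1 e.2 = dBot Adj w s t

/-- A path is retractable if either it has no edges, or it contains the bottleneck edge
`(u,v)` of its endpoints, and the subpath from its start to `u` and the subpath from `v`
to its end are both retractable. -/
inductive Retractable (Adj : V → V → Prop) (w : V → V → ℝ) : List V → Prop
  | single (v : V) : Retractable Adj w [v]
  | split (l₁ l₂ : List V) (u v s t : V)
      (h₁ : l₁.getLast? = some u) (h₂ : l₂.head? = some v)
      (hs : (l₁ ++ l₂).head? = some s) (ht : (l₁ ++ l₂).getLast? = some t)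
      (hbtl : IsBtlEdge Adj w s t (u, v))
      (r₁ : Retractable Adj w l₁) (r₂ : Retractable Adj w l₂) :
      Retractable Adj w (l₁ ++ l₂)

namespace RetractablePath

section Walks

variable {R : V → V → Prop} {s t u v x : V} {l l₁ l₂ : List V}

theorem mem_zip_tail_iff :
    ∀ {l : List V}, (u, v) ∈ l.zip l.tail ↔ ∃ l₁ l₂, l = l₁ ++ u :: v :: l₂
  | [] => by simp
  | [a] => by
    simp only [List.tail_cons, List.zip_nil_right, List.not_mem_nil, false_iff]
    rintro ⟨l₁, l₂, h⟩
    have := congrArg List.length h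
    simp at this
    omega
  | a :: b :: l => by
    have ih := @mem_zip_tail_iff (b :: l)
    simp only [List.tail_cons, List.zip_cons_cons, List.mem_cons, Prod.mk.injEq] at ih ⊢
    rw [ih]
    constructor
    · rintro (⟨rfl, rfl⟩ | ⟨l₁, l₂, h⟩)
      · exact ⟨[], l, rfl⟩
      · exact ⟨a :: l₁, l₂, by simp [h]⟩
    · rintro ⟨_ | ⟨c, l₁⟩, l₂, h⟩
      · simp only [List.nil_append, List.cons.injEq] at h
        exact Or.inl ⟨h.1.symm, h.2.1.symm⟩
      · simp only [List.cons_append, List.cons.injEq] at h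
        exact Or.inr ⟨l₁, l₂, h.2⟩

theorem isChain_iff_forall_mem_zip :
    ∀ {l : List V}, l.IsChain R ↔ ∀ a b, (a, b) ∈ l.zip l.tail → R a b
  | [] => by simp
  | [a] => by simp
  | a :: b :: l => by
    have ih := @isChain_iff_forall_mem_zip (b :: l)
    simp only [List.tail_cons] at ih
    simp only [List.isChain_cons_cons, ih, List.tail_cons, List.zip_cons_cons, List.mem_cons,
      Prod.mk.injEq]
    constructor
    · rintro ⟨h, h'⟩ c d (⟨rfl, rfl⟩ | hcd)
      · exact h
      · exact h' c d hcd
    · exact fun h => ⟨h a b (Or.inl ⟨rfl, rfl⟩), fun c d hcd => h c d (Or.inr hcd)⟩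

theorem _root_.IsDiPath.mono {S : V → V → Prop} (h : ∀ a b, R a b → S a b)
    (hl : IsDiPath R s t l) : IsDiPath S s t l :=
  ⟨hl.1, hl.2.1, List.IsChain.imp h hl.2.2⟩

theorem _root_.IsDiPath.append (h₁ : IsDiPath R s u l₁) (h : R u v) (h₂ : IsDiPath R v t l₂) :
    IsDiPath R s t (l₁ ++ l₂) := by
  obtain ⟨a, b, c⟩ := h₁
  obtain ⟨a', b', c'⟩ := h₂
  refine ⟨by simp [List.head?_append, a], by simp [List.getLast?_append, b'], ?_⟩
  refine List.isChain_append.2 ⟨c, c', ?_⟩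
  simp_all

theorem _root_.IsDiPath.reflTransGen : ∀ {s : V} {l : List V}, IsDiPath R s t l →
    ∀ x ∈ l, Relation.ReflTransGen R s x ∧ Relation.ReflTransGen R x t
  | _, [], h => by simp
  | s, [a], h => by
    obtain ⟨h₁, h₂, -⟩ := h
    simp only [List.head?_cons, List.getLast?_singleton, Option.some.injEq] at h₁ h₂
    subst h₁ h₂
    intro x hx
    rw [List.mem_singleton.1 hx]
    exact ⟨.refl, .refl⟩
  | s, a :: b :: l, h => by
    obtain ⟨h₁, h₂, h₃⟩ := h
    simp only [List.head?_cons, Option.some.injEq] at h₁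
    subst h₁
    have h₃' : R a b ∧ (b :: l).IsChain R := List.isChain_cons_cons.1 h₃
    have ih := IsDiPath.reflTransGen (s := b) (l := b :: l) ⟨rfl, by simpa using h₂, h₃'.2⟩
    intro x hx
    rcases List.mem_cons.1 hx with rfl | hx
    · exact ⟨.refl, .head h₃'.1 (ih b (by simp)).2⟩
    · exact ⟨.head h₃'.1 (ih x hx).1, (ih x hx).2⟩

theorem exists_nodup_isDiPath (h : Relation.ReflTransGen R s t) :
    ∃ l, IsDiPath R s t l ∧ l.Nodup := by
  induction h using Relation.ReflTransGen.head_induction_on with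
  | refl => exact ⟨[t], ⟨rfl, rfl, List.isChain_singleton t⟩, by simp⟩
  | @head a b hab _ ih =>
    obtain ⟨l, hl, hn⟩ := ih
    by_cases ha : a ∈ l
    · obtain ⟨l₁, l₂, rfl⟩ := List.append_of_mem ha
      refine ⟨a :: l₂, ⟨rfl, ?_, ?_⟩, (List.nodup_append.1 hn).2.1⟩
      · simpa using hl.2.1
      · exact (List.isChain_append.1 hl.2.2).2.1
    · exact ⟨a :: l, IsDiPath.append (l₁ := [a]) ⟨rfl, rfl, List.isChain_singleton a⟩ hab hl,
        List.nodup_cons.2 ⟨ha, hn⟩⟩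

theorem _root_.IsDiPath.eq_singleton (h : IsDiPath R s s l) (hn : l.Nodup) : l = [s] := by
  obtain ⟨h₁, h₂, -⟩ := h
  cases l with
  | nil => simp at h₁
  | cons a l =>
    simp only [List.head?_cons, Option.some.injEq] at h₁
    subst h₁
    cases l with
    | nil => rfl
    | cons b l =>
      rw [List.getLast?_cons_cons] at h₂
      exact absurd (List.mem_of_getLast? h₂) (List.nodup_cons.1 hn).1

theorem _root_.IsDiPath.zip_tail_nonempty (h : IsDiPath R s t l) (hst : s ≠ t) :
    ∃ e, e ∈ l.zip l.tail := by
  obtain ⟨h₁, h₂, -⟩ := h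
  match l, h₁, h₂ with
  | [], h₁, _ => simp at h₁
  | [a], h₁, h₂ =>
    simp only [List.head?_cons, List.getLast?_singleton, Option.some.injEq] at h₁ h₂
    exact absurd (h₁.symm.trans h₂) hst
  | a :: b :: l, _, _ => exact ⟨(a, b), by simp⟩

end Walks

section Bottleneck

variable {Adj : V → V → Prop} {w : V → V → ℝ} {s t : V} {l : List V}

theorem finite_edgeWeights (w : V → V → ℝ) (l : List V) :
    ((fun e : V × V => w e.1 e.2) '' { e | e ∈ l.zip l.tail }).Finite :=
  (List.finite_toSet _).image _

theorem le_bottleneck {e : V × V} (he : e ∈ l.zip l.tail) : w e.1 e.2 ≤ bottleneck w l :=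
  le_csSup (finite_edgeWeights w l).bddAbove ⟨e, he, rfl⟩

theorem exists_eq_bottleneck (h : ∃ e, e ∈ l.zip l.tail) :
    ∃ e ∈ l.zip l.tail, w e.1 e.2 = bottleneck w l :=
  (Set.Nonempty.image (fun e : V × V => w e.1 e.2) h).csSup_mem (finite_edgeWeights w l)

theorem finite_pathBottlenecks [Finite V] (Adj : V → V → Prop) (w : V → V → ℝ) (s t : V) :
    { r | ∃ l, IsDiPath Adj s t l ∧ l.Nodup ∧ r = bottleneck w l }.Finite := by
  classical
  have := Fintype.ofFinite V
  refine (Set.finite_range fun l : { l : List V // l.Nodup } => bottleneck w l.1).subset ?_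
  rintro r ⟨l, -, hn, rfl⟩
  exact ⟨⟨l, hn⟩, rfl⟩

/-- The edges of weight less than `c`. -/
def LightAdj (Adj : V → V → Prop) (w : V → V → ℝ) (c : ℝ) (a b : V) : Prop :=
  Adj a b ∧ w a b < c

theorem dBot_lt [Finite V] (hst : s ≠ t) {c : ℝ}
    (h : Relation.ReflTransGen (LightAdj Adj w c) s t) : dBot Adj w s t < c := by
  obtain ⟨l, hl, hn⟩ := exists_nodup_isDiPath h
  obtain ⟨e, he, hwe⟩ := exists_eq_bottleneck (w := w) (hl.zip_tail_nonempty hst)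
  calc dBot Adj w s t ≤ bottleneck w l :=
        csInf_le (finite_pathBottlenecks Adj w s t).bddBelow
          ⟨l, hl.mono fun _ _ h => h.1, hn, rfl⟩
    _ = w e.1 e.2 := hwe.symm
    _ < c := (isChain_iff_forall_mem_zip.1 hl.2.2 e.1 e.2 he).2

theorem _root_.IsBtlEdge.adj {e : V × V} (h : IsBtlEdge Adj w s t e) : Adj e.1 e.2 := by
  obtain ⟨l, hl, -, -, he, -⟩ := h
  exact isChain_iff_forall_mem_zip.1 hl.2.2 _ _ he

theorem _root_.IsBtlEdge.weight_eq {e : V × V} (h : IsBtlEdge Adj w s t e) :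
    w e.1 e.2 = dBot Adj w s t := by
  obtain ⟨l, -, -, -, -, he⟩ := h
  exact he

/-- The bottleneck edge splits an optimal path into two parts made of strictly lighter edges. -/
theorem exists_isBtlEdge [Finite V]
    (hw : ∀ a b a' b', Adj a b → Adj a' b' → w a b = w a' b' → (a, b) = (a', b'))
    (hst : s ≠ t) (h : Relation.ReflTransGen Adj s t) :
    ∃ u v, IsBtlEdge Adj w s t (u, v) ∧
      Relation.ReflTransGen (LightAdj Adj w (dBot Adj w s t)) s u ∧
      Relation.ReflTransGen (LightAdj Adj w (dBot Adj w s t)) v t := by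
  obtain ⟨l', hl', hn'⟩ := exists_nodup_isDiPath h
  have hne : { r | ∃ l, IsDiPath Adj s t l ∧ l.Nodup ∧ r = bottleneck w l }.Nonempty :=
    ⟨_, l', hl', hn', rfl⟩
  obtain ⟨l, hl, hn, hd⟩ := hne.csInf_mem (finite_pathBottlenecks Adj w s t)
  change dBot Adj w s t = _ at hd
  obtain ⟨⟨u, v⟩, he, hwe⟩ := exists_eq_bottleneck (w := w) (hl.zip_tail_nonempty hst)
  refine ⟨u, v, ⟨l, hl, hn, hd.symm, he, hwe.trans hd.symm⟩, ?_⟩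
  have hadj := isChain_iff_forall_mem_zip.1 hl.2.2
  have light : ∀ a b, (a, b) ∈ l.zip l.tail → (a, b) ≠ (u, v) →
      LightAdj Adj w (dBot Adj w s t) a b := fun a b hab hne =>
    ⟨hadj a b hab, hd ▸ lt_of_le_of_ne (le_bottleneck hab) fun heq =>
      hne (hw _ _ _ _ (hadj a b hab) (hadj u v he) (heq.trans hwe.symm))⟩
  obtain ⟨l₁, l₂, rfl⟩ := mem_zip_tail_iff.1 he
  constructor
  · have hp : IsDiPath (LightAdj Adj w (dBot Adj w s t)) s u (l₁ ++ [u]) := by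
      refine ⟨by simpa [List.head?_append] using hl.1, by simp, ?_⟩
      refine isChain_iff_forall_mem_zip.2 fun a b hab => ?_
      obtain ⟨m₁, m₂, hm⟩ := mem_zip_tail_iff.1 hab
      have hsplit : l₁ ++ u :: v :: l₂ = m₁ ++ a :: b :: (m₂ ++ v :: l₂) := by
        have := congrArg (· ++ v :: l₂) hm
        simpa using this
      refine light a b (mem_zip_tail_iff.2 ⟨_, _, hsplit⟩) ?_
      rintro ⟨⟩
      rw [hsplit] at hn
      simp [List.nodup_append] at hn
    exact (hp.reflTransGen u (by simp)).1
  · have hp : IsDiPath (LightAdj Adj w (dBot Adj w s t)) v t (v :: l₂) := by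
      refine ⟨rfl, by simpa using hl.2.1, ?_⟩
      refine isChain_iff_forall_mem_zip.2 fun a b hab => ?_
      obtain ⟨m₁, m₂, hm⟩ := mem_zip_tail_iff.1 hab
      have hsplit : l₁ ++ u :: v :: l₂ = (l₁ ++ u :: m₁) ++ a :: b :: m₂ := by
        simp [hm]
      refine light a b (mem_zip_tail_iff.2 ⟨_, _, hsplit⟩) ?_
      rintro ⟨⟩
      rw [hsplit] at hn
      simp [List.nodup_append] at hn
    exact (hp.reflTransGen v (by simp)).2

theorem exists_retractable [Finite V]
    (hw : ∀ a b a' b', Adj a b → Adj a' b' → w a b = w a' b' → (a, b) = (a', b'))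
    (c : ℝ) (s t : V) (h : Relation.ReflTransGen (LightAdj Adj w c) s t) :
    ∃ l, IsDiPath (LightAdj Adj w c) s t l ∧ l.Nodup ∧ Retractable Adj w l := by
  induction hk : { e : V × V | LightAdj Adj w c e.1 e.2 }.ncard using Nat.strong_induction_on
    generalizing c s t with
  | _ k ih =>
  by_cases hst : s = t
  · subst hst
    exact ⟨[s], ⟨rfl, rfl, List.isChain_singleton s⟩, by simp, .single s⟩
  obtain ⟨u, v, huv, hsu, hvt⟩ :=
    exists_isBtlEdge hw hst (Relation.ReflTransGen.mono (fun _ _ h => h.1) _ _ h)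
  have hdc := dBot_lt hst h
  have hwe := huv.weight_eq
  have hlt : { e : V × V | LightAdj Adj w (dBot Adj w s t) e.1 e.2 }.ncard < k := by
    rw [← hk]
    refine Set.ncard_lt_ncard ⟨fun e he => ⟨he.1, he.2.trans hdc⟩, fun hsub => ?_⟩
      (Set.toFinite _)
    have : (u, v) ∈ { e : V × V | LightAdj Adj w (dBot Adj w s t) e.1 e.2 } :=
      hsub ⟨huv.adj, hwe.trans_lt hdc⟩
    exact this.2.ne hwe
  obtain ⟨l₁, hl₁, hn₁, hr₁⟩ := ih _ hlt _ s u hsu rfl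
  obtain ⟨l₂, hl₂, hn₂, hr₂⟩ := ih _ hlt _ v t hvt rfl
  have hmono : ∀ a b, LightAdj Adj w (dBot Adj w s t) a b → LightAdj Adj w c a b :=
    fun a b h => ⟨h.1, h.2.trans hdc⟩
  have hp := (hl₁.mono hmono).append ⟨huv.adj, hwe.trans_lt hdc⟩ (hl₂.mono hmono)
  refine ⟨l₁ ++ l₂, hp, hn₁.append hn₂ fun x hx₁ hx₂ => ?_,
    .split l₁ l₂ u v s t hl₁.2.1 hl₂.1 hp.1 hp.2.1 huv hr₁ hr₂⟩
  exact (dBot_lt hst ((hl₁.reflTransGen x hx₁).1.trans (hl₂.reflTransGen x hx₂).2)).false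

theorem eq_of_retractable
    (hw : ∀ a b a' b', Adj a b → Adj a' b' → w a b = w a' b' → (a, b) = (a', b'))
    {l l' : List V} (hr : Retractable Adj w l) (hr' : Retractable Adj w l') {s t : V}
    (hl : IsDiPath Adj s t l) (hn : l.Nodup) (hl' : IsDiPath Adj s t l') (hn' : l'.Nodup) :
    l = l' := by
  induction hr generalizing l' s t with
  | single a =>
    obtain ⟨h₁, h₂, -⟩ := hl
    simp only [List.head?_cons, List.getLast?_singleton, Option.some.injEq] at h₁ h₂
    subst h₁ h₂
    exact (hl'.eq_singleton hn').symm
  | split l₁ l₂ u v s₀ t₀ h₁ h₂ hs ht hbtl _ _ ih₁ ih₂ =>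
    cases hr' with
    | single a =>
      obtain ⟨h₁, h₂, -⟩ := hl'
      simp only [List.head?_cons, List.getLast?_singleton, Option.some.injEq] at h₁ h₂
      subst h₁ h₂
      exact hl.eq_singleton hn
    | split m₁ m₂ u' v' s₁ t₁ h₁' h₂' hs' ht' hbtl' r₁ r₂ =>
      obtain rfl : s₀ = s := Option.some.inj (hs.symm.trans hl.1)
      obtain rfl : t₀ = t := Option.some.inj (ht.symm.trans hl.2.1)
      obtain rfl : s₁ = s₀ := Option.some.inj (hs'.symm.trans hl'.1)
      obtain rfl : t₁ = t₀ := Option.some.inj (ht'.symm.trans hl'.2.1)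
      obtain ⟨rfl, rfl⟩ := Prod.mk.inj
        (hw _ _ _ _ hbtl.adj hbtl'.adj (hbtl.weight_eq.trans hbtl'.weight_eq.symm))
      have parts : ∀ {k₁ k₂ : List V}, IsDiPath Adj s₁ t₁ (k₁ ++ k₂) →
          k₁.getLast? = some u → k₂.head? = some v →
          IsDiPath Adj s₁ u k₁ ∧ IsDiPath Adj v t₁ k₂ := by
        intro k₁ k₂ hk hu hv
        have hne₁ : k₁ ≠ [] := by rintro rfl; simp at hu
        have hne₂ : k₂ ≠ [] := by rintro rfl; simp at hv
        have hc := List.isChain_append.1 hk.2.2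
        refine ⟨⟨?_, hu, hc.1⟩, ⟨hv, ?_, hc.2.1⟩⟩
        · rw [← List.head?_append_of_ne_nil _ hne₁]
          exact hk.1
        · rw [← List.getLast?_append_of_ne_nil _ hne₂]
          exact hk.2.1
      obtain ⟨p₁, p₂⟩ := parts hl h₁ h₂
      obtain ⟨q₁, q₂⟩ := parts hl' h₁' h₂'
      have hn := List.nodup_append.1 hn
      have hn' := List.nodup_append.1 hn'
      rw [ih₁ r₁ p₁ hn.1 q₁ hn'.1, ih₂ r₂ p₂ hn.2.1 q₂ hn'.2.1]

end Bottleneck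

end RetractablePath

/-- In a finite directed graph with pairwise distinct edge weights, for
any two vertices joined by some directed path there is exactly one retractable simple
directed path between them. -/
theorem retractable_path_unique [Fintype V]
    (Adj : V → V → Prop) (w : V → V → ℝ)
    (hw : ∀ a b a' b', Adj a b → Adj a' b' → w a b = w a' b' → (a, b) = (a', b'))
    (s t : V) (hconn : ∃ l, IsDiPath Adj s t l) :
    ∃! l : List V, IsDiPath Adj s t l ∧ l.Nodup ∧ Retractable Adj w l := by
  obtain ⟨l₀, hl₀⟩ := hconn
  obtain ⟨C, hC⟩ := (Set.finite_range fun e : V × V => w e.1 e.2).bddAbove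
  have hlight : ∀ a b, Adj a b → RetractablePath.LightAdj Adj w (C + 1) a b := fun a b hab =>
    ⟨hab, lt_of_le_of_lt (hC ⟨(a, b), rfl⟩) (lt_add_one C)⟩
  obtain ⟨l, hl, hn, hr⟩ := RetractablePath.exists_retractable hw (C + 1) s t
    ((hl₀.mono hlight).reflTransGen t (List.mem_of_getLast? hl₀.2.1)).1
  have hl := hl.mono fun _ _ h => h.1
  exact ⟨l, ⟨hl, hn, hr⟩, fun l' ⟨hl', hn', hr'⟩ =>
    RetractablePath.eq_of_retractable hw hr' hr hl' hn' hl hn⟩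
end

section
/- Let p_1,…,p_n and q_1,…,q_m be two sequences of points in ℝ^d such that the distances ‖p_i − q_j‖, for (i,j) ∈ {1,…,n}×{1,…,m}, are pairwise distinct. Then there exists exactly one retractable discrete Fréchet morphing between the two sequences. -/
open Set

/-- A single step of a monotone grid path: exactly one coordinate increases by `1`. -/
def GridStep (z z' : ℕ × ℕ) : Prop :=
  (z'.1 = z.1 + 1 ∧ z'.2 = z.2) ∨ (z'.1 = z.1 ∧ z'.2 = z.2 + 1)

/-- A monotone grid path from `z` to `z'` inside the grid `{0,…,n−1} × {0,…,m−1}`. -/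
def GridPath (n m : ℕ) (l : List (ℕ × ℕ)) (z z' : ℕ × ℕ) : Prop :=
  l.head? = some z ∧ l.getLast? = some z' ∧ l.Chain' GridStep ∧
    ∀ zz ∈ l, zz.1 < n ∧ zz.2 < m

/-- The inner width of a grid path: the maximum weight `dist (p i) (q j)` of an interior
vertex `(i,j)` of the path. -/
noncomputable def innerWidth {d : ℕ} (p q : ℕ → EuclideanSpace ℝ (Fin d))
    (l : List (ℕ × ℕ)) : ℝ :=
  sSup ((fun zz : ℕ × ℕ => dist (p zz.1) (q zz.2)) '' { zz | zz ∈ l.tail.dropLast })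

/-- The minimum inner width of a monotone grid path from `z` to `z'` having at least one
interior vertex. -/
noncomputable def dGrid {d : ℕ} (n m : ℕ) (p q : ℕ → EuclideanSpace ℝ (Fin d))
    (z z' : ℕ × ℕ) : ℝ :=
  sInf { r | ∃ l, GridPath n m l z z' ∧ l.tail.dropLast ≠ [] ∧ r = innerWidth p q l }

/-- `x` is the bottleneck of `z` and `z'`: the grid point of weight `dGrid n m p q z z'`
that is an interior vertex of a minimum-inner-width monotone grid path from `z` to `z'`. -/
def IsBtl {d : ℕ} (n m : ℕ) (p q : ℕ → EuclideanSpace ℝ (Fin d))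
    (z z' x : ℕ × ℕ) : Prop :=
  ∃ l, GridPath n m l z z' ∧ l.tail.dropLast ≠ [] ∧ x ∈ l.tail.dropLast ∧
    innerWidth p q l = dGrid n m p q z z' ∧ dist (p x.1) (q x.2) = dGrid n m p q z z'

/-- A discrete morphing between the point sequences `p 0, …, p (n−1)` and
`q 0, …, q (m−1)`: a monotone grid path from `(0,0)` to `(n−1, m−1)`. -/
def IsDiscreteMorphing (n m : ℕ) (C : List (ℕ × ℕ)) : Prop :=
  GridPath n m C (0, 0) (n - 1, m - 1)

/-- A discrete morphing `C` is retractable if for all indices `a < b` such that every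
monotone grid path between the corresponding grid points has an interior vertex, the
bottleneck of these two grid points lies on the subpath of `C` between them. -/
def IsRetractableMorphing {d : ℕ} (n m : ℕ) (p q : ℕ → EuclideanSpace ℝ (Fin d))
    (C : List (ℕ × ℕ)) : Prop :=
  ∀ a b : ℕ, a < b → b < C.length →
    (∀ l, GridPath n m l (C.getD a (0, 0)) (C.getD b (0, 0)) → l.tail.dropLast ≠ []) →
    ∀ x, IsBtl n m p q (C.getD a (0, 0)) (C.getD b (0, 0)) x →
      x ∈ (C.drop a).take (b - a + 1)

section GridPaths

variable {n m : ℕ} {z z' u v x : ℕ × ℕ}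

theorem gridPath_append_cons_iff {l₁ l₂ : List (ℕ × ℕ)} :
    GridPath n m (l₁ ++ x :: l₂) z z' ↔
      GridPath n m (l₁ ++ [x]) z x ∧ GridPath n m (x :: l₂) x z' := by
  have hhead : (l₁ ++ x :: l₂).head? = (l₁ ++ [x]).head? := by cases l₁ <;> rfl
  have hlast : (l₁ ++ x :: l₂).getLast? = (x :: l₂).getLast? := by
    rw [List.getLast?_append_of_ne_nil _ (by simp)]
  have hchain : (l₁ ++ x :: l₂).Chain' GridStep ↔
      (l₁ ++ [x]).Chain' GridStep ∧ (x :: l₂).Chain' GridStep := List.isChain_split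
  unfold GridPath
  rw [hhead, hlast, hchain]
  constructor
  · rintro ⟨h1, h2, ⟨h3, h4⟩, h5⟩
    exact ⟨⟨h1, by simp, h3, fun y hy => h5 y (by simp at hy ⊢; tauto)⟩,
      ⟨by simp, h2, h4, fun y hy => h5 y (by simp at hy ⊢; tauto)⟩⟩
  · rintro ⟨⟨h1, _, h3, h5⟩, ⟨_, h2, h4, h6⟩⟩
    refine ⟨h1, h2, ⟨h3, h4⟩, fun y hy => ?_⟩
    rcases List.mem_append.1 hy with hy | hy
    · exact h5 y (by simp [hy])
    · exact h6 y hy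

theorem GridPath.subpath {l₁ s l₂ : List (ℕ × ℕ)}
    (h : GridPath n m (l₁ ++ u :: (s ++ v :: l₂)) z z') : GridPath n m (u :: (s ++ [v])) u v := by
  have h' := (gridPath_append_cons_iff.1 h).2
  rw [← List.cons_append, gridPath_append_cons_iff] at h'
  exact h'.1

theorem gridPath_singleton (h₁ : z.1 < n) (h₂ : z.2 < m) : GridPath n m [z] z z :=
  ⟨by simp, by simp, List.isChain_singleton _, by simp [h₁, h₂]⟩

theorem GridPath.concat {l : List (ℕ × ℕ)} (h : GridPath n m l z u) (hs : GridStep u v)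
    (h₁ : v.1 < n) (h₂ : v.2 < m) : GridPath n m (l ++ [v]) z v := by
  obtain ⟨hh, hl, hc, hb⟩ := h
  refine ⟨?_, by simp, ?_, ?_⟩
  · cases l <;> simp_all
  · refine List.IsChain.append hc (List.isChain_singleton _) fun a ha b hb => ?_
    simp_all
  · intro y hy
    rcases List.mem_append.1 hy with hy | hy
    · exact hb y hy
    · simp_all

theorem exists_gridPath : ∀ i j : ℕ, i < n → j < m → ∃ l, GridPath n m l (0, 0) (i, j)
  | 0, 0, hi, hj => ⟨_, gridPath_singleton hi hj⟩
  | i + 1, 0, hi, hj => by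
    obtain ⟨l, hl⟩ := exists_gridPath i 0 (by omega) hj
    exact ⟨_, hl.concat (v := (i + 1, 0)) (Or.inl ⟨rfl, rfl⟩) hi hj⟩
  | i, j + 1, hi, hj => by
    obtain ⟨l, hl⟩ := exists_gridPath i j hi (by omega)
    exact ⟨_, hl.concat (v := (i, j + 1)) (Or.inr ⟨rfl, rfl⟩) hi hj⟩

theorem GridPath.eq_cons_of_tail_dropLast_ne_nil {l : List (ℕ × ℕ)} (h : GridPath n m l z z')
    (hl : l.tail.dropLast ≠ []) : l = z :: (l.tail.dropLast ++ [z']) := by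
  obtain ⟨hh, ht, -⟩ := h
  cases l with
  | nil => simp at hl
  | cons a t =>
    have hne : t ≠ [] := by rintro rfl; simp at hl
    have ha : a = z := by simpa using hh
    rw [List.getLast?_cons_of_ne_nil hne, List.getLast?_eq_some_getLast hne] at ht
    have hz : t.getLast hne = z' := by simpa using ht
    rw [ha, ← hz, List.tail_cons, List.dropLast_append_getLast]

theorem GridPath.pairwise_add_lt {l : List (ℕ × ℕ)} (h : GridPath n m l z z') :
    l.Pairwise fun a b => a.1 + a.2 < b.1 + b.2 := by
  have : (l.map fun a => a.1 + a.2).IsChain (· < ·) := by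
    refine List.isChain_map_of_isChain _ (fun a b hab => ?_) h.2.2.1
    rcases hab with ⟨h1, h2⟩ | ⟨h1, h2⟩ <;> omega
  exact List.pairwise_map.1 this.pairwise

theorem GridPath.nodup {l : List (ℕ × ℕ)} (h : GridPath n m l z z') : l.Nodup :=
  h.pairwise_add_lt.imp fun hab he => by subst he; exact lt_irrefl _ hab

theorem GridPath.add_length : ∀ {l : List (ℕ × ℕ)} {z : ℕ × ℕ}, GridPath n m l z z' →
    z.1 + z.2 + l.length = z'.1 + z'.2 + 1
  | [], _, h => by simp [GridPath] at h
  | [a], z, h => by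
    obtain ⟨h1, h2, -⟩ := h
    simp at h1 h2
    subst h1 h2
    simp
  | a :: b :: l, z, h => by
    obtain ⟨h1, h2⟩ := (gridPath_append_cons_iff (l₁ := [a]) (x := b) (l₂ := l)).1 h
    have := h2.add_length
    have ha : a = z := by simpa using h1.1
    have hs : GridStep a b := List.isChain_pair.1 h1.2.2.1
    subst ha
    rcases hs with ⟨_, _⟩ | ⟨_, _⟩ <;> simp only [List.length_cons] at this ⊢ <;> omega

theorem GridPath.length_eq {l l' : List (ℕ × ℕ)} (h : GridPath n m l z z')
    (h' : GridPath n m l' z z') : l.length = l'.length := by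
  have := h.add_length
  have := h'.add_length
  omega

theorem GridPath.tail_dropLast_ne_nil {s l : List (ℕ × ℕ)} (h : GridPath n m (u :: (s ++ [v])) u v)
    (hs : s ≠ []) (h' : GridPath n m l u v) : l.tail.dropLast ≠ [] := by
  have := h.length_eq h'
  have := List.length_pos_iff.2 hs
  rw [← List.length_pos_iff]
  simp at *
  omega

/-- Every subpath of `C` has minimum inner width for the weight `w` among the grid paths with
the same endpoints. -/
def IsLocallyOptimal (n m : ℕ) (w : ℕ × ℕ → ℝ) (C : List (ℕ × ℕ)) : Prop :=
  ∀ l₁ u s v l₂ s', C = l₁ ++ u :: (s ++ v :: l₂) → GridPath n m (u :: (s' ++ [v])) u v →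
    ∀ y ∈ s, ∃ x ∈ s', w y ≤ w x

theorem exists_rank (n m : ℕ) (w : ℕ × ℕ → ℝ) :
    ∃ f : ℕ × ℕ → ℕ, ∀ a b : ℕ × ℕ, a.1 < n → a.2 < m → w a < w b → f a < f b := by
  classical
  refine ⟨fun a => ((Finset.range n ×ˢ Finset.range m).filter fun c => w c < w a).card,
    fun a b h1 h2 hab => Finset.card_lt_card ?_⟩
  refine (Finset.ssubset_iff_of_subset fun c hc => ?_).2 ⟨a, ?_, ?_⟩
  · rw [Finset.mem_filter] at hc ⊢
    exact ⟨hc.1, hc.2.trans hab⟩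
  · simp [h1, h2, hab]
  · simp

theorem List.sum_map_two_pow_lt {α : Type*} {f : α → ℕ} {s : List α} {k : ℕ}
    (hs : (s.map f).Nodup) (hk : ∀ x ∈ s, f x < k) : (s.map fun x => 2 ^ f x).sum < 2 ^ k := by
  have h := Nat.geomSum_lt (m := 2) (s := (s.map f).toFinset) (n := k) le_rfl (by simpa using hk)
  rw [List.sum_toFinset _ hs] at h
  simpa [Function.comp_def] using h

theorem exists_isLocallyOptimal {w : ℕ × ℕ → ℝ}
    (hw : ∀ a b : ℕ × ℕ, a.1 < n → a.2 < m → b.1 < n → b.2 < m → w a = w b → a = b)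
    (h : ∃ l, GridPath n m l z z') : ∃ C, GridPath n m C z z' ∧ IsLocallyOptimal n m w C := by
  obtain ⟨f, hf⟩ := exists_rank n m w
  let cost : List (ℕ × ℕ) → ℕ := fun l => (l.map fun x => 2 ^ f x).sum
  obtain ⟨C, hC, hmin⟩ := (measure cost).wf.has_min {l | GridPath n m l z z'} h
  refine ⟨C, hC, fun l₁ u s v l₂ s' hdec hs' y hy => ?_⟩
  by_contra! hlt
  subst hdec
  obtain ⟨h1, h2⟩ := gridPath_append_cons_iff.1 hC
  rw [← List.cons_append, gridPath_append_cons_iff] at h2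
  obtain ⟨h2, h3⟩ := h2
  have hb : ∀ a ∈ s', a.1 < n ∧ a.2 < m := fun a ha => hs'.2.2.2 a (by simp [ha])
  have hyb : y.1 < n ∧ y.2 < m := h2.2.2.2 y (by simp [hy])
  have hnew : GridPath n m (l₁ ++ u :: (s' ++ v :: l₂)) z z' := by
    refine gridPath_append_cons_iff.2 ⟨h1, ?_⟩
    rw [← List.cons_append, gridPath_append_cons_iff]
    exact ⟨hs', h3⟩
  refine hmin _ hnew ?_
  have hnd : (s'.map f).Nodup := by
    have hnd' : s'.Nodup := (List.nodup_append.1 (List.nodup_cons.1 hs'.nodup).2).1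
    refine hnd'.map_on fun a ha b hb' hab => ?_
    refine hw a b (hb a ha).1 (hb a ha).2 (hb b hb').1 (hb b hb').2 ?_
    rcases lt_trichotomy (w a) (w b) with h | h | h
    · exact absurd hab (hf a b (hb a ha).1 (hb a ha).2 h).ne
    · exact h
    · exact absurd hab (hf b a (hb b hb').1 (hb b hb').2 h).ne'
  have hsum : (s'.map fun x => 2 ^ f x).sum < 2 ^ f y :=
    List.sum_map_two_pow_lt hnd fun a ha => hf a y (hb a ha).1 (hb a ha).2 (hlt a ha)
  have hle : 2 ^ f y ≤ (s.map fun x => 2 ^ f x).sum :=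
    List.single_le_sum (by simp) _ (List.mem_map.2 ⟨y, hy, rfl⟩)
  change cost _ < cost _
  simp only [cost, List.map_append, List.map_cons, List.sum_append, List.sum_cons]
  omega

section Width

variable {d : ℕ} {p q : ℕ → EuclideanSpace ℝ (Fin d)}

theorem finite_image_mem (w : ℕ × ℕ → ℝ) (s : List (ℕ × ℕ)) : (w '' {y | y ∈ s}).Finite :=
  s.finite_toSet.image w

theorem le_innerWidth {l : List (ℕ × ℕ)} {y : ℕ × ℕ} (hy : y ∈ l.tail.dropLast) :
    dist (p y.1) (q y.2) ≤ innerWidth p q l :=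
  le_csSup (finite_image_mem (fun y => dist (p y.1) (q y.2)) _).bddAbove ⟨y, hy, rfl⟩

theorem exists_mem_eq_innerWidth {l : List (ℕ × ℕ)} (hl : l.tail.dropLast ≠ []) :
    ∃ y ∈ l.tail.dropLast, dist (p y.1) (q y.2) = innerWidth p q l := by
  obtain ⟨y, hy⟩ := List.exists_mem_of_ne_nil _ hl
  exact Set.Nonempty.csSup_mem (Set.Nonempty.image _ ⟨y, hy⟩)
    (finite_image_mem (fun y => dist (p y.1) (q y.2)) l.tail.dropLast)

theorem finite_setOf_innerWidth (n m : ℕ) (p q : ℕ → EuclideanSpace ℝ (Fin d)) (z z' : ℕ × ℕ) :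
    {r | ∃ l, GridPath n m l z z' ∧ l.tail.dropLast ≠ [] ∧ r = innerWidth p q l}.Finite := by
  refine (((finite_Iio n).prod (finite_Iio m)).image
    fun y : ℕ × ℕ => dist (p y.1) (q y.2)).subset ?_
  rintro r ⟨l, hl, hne, rfl⟩
  obtain ⟨y, hy, hyw⟩ := exists_mem_eq_innerWidth (p := p) (q := q) hne
  exact ⟨y, hl.2.2.2 y (List.mem_of_mem_tail (List.mem_of_mem_dropLast hy)), hyw⟩

theorem dGrid_le {l : List (ℕ × ℕ)} (h : GridPath n m l z z') (hl : l.tail.dropLast ≠ []) :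
    dGrid n m p q z z' ≤ innerWidth p q l :=
  csInf_le (finite_setOf_innerWidth n m p q z z').bddBelow ⟨l, h, hl, rfl⟩

theorem exists_isBtl {l : List (ℕ × ℕ)} (h : GridPath n m l z z') (hl : l.tail.dropLast ≠ []) :
    ∃ x, IsBtl n m p q z z' x := by
  obtain ⟨l', h', hl', hw⟩ := Set.Nonempty.csInf_mem
    (⟨_, l, h, hl, rfl⟩ : {r | ∃ l, GridPath n m l z z' ∧ l.tail.dropLast ≠ [] ∧
      r = innerWidth p q l}.Nonempty) (finite_setOf_innerWidth n m p q z z')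
  obtain ⟨x, hx, hxw⟩ := exists_mem_eq_innerWidth (p := p) (q := q) hl'
  exact ⟨x, l', h', hl', hx, hw.symm, hxw.trans hw.symm⟩

theorem IsBtl.ne (h : IsBtl n m p q u v x) : x ≠ u ∧ x ≠ v := by
  obtain ⟨l, hl, hne, hx, -⟩ := h
  have hnd := hl.nodup
  rw [hl.eq_cons_of_tail_dropLast_ne_nil hne] at hnd
  constructor
  · rintro rfl
    exact (List.nodup_cons.1 hnd).1 (List.mem_append_left _ hx)
  · rintro rfl
    exact List.disjoint_of_nodup_append (List.nodup_cons.1 hnd).2 hx (by simp)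

/-- Every bottleneck of two vertices of `C` lies strictly between them on `C`. -/
def ContainsBtls (n m : ℕ) (p q : ℕ → EuclideanSpace ℝ (Fin d)) (C : List (ℕ × ℕ)) : Prop :=
  ∀ l₁ u s v l₂, C = l₁ ++ u :: (s ++ v :: l₂) → s ≠ [] → ∀ x, IsBtl n m p q u v x → x ∈ s

theorem ContainsBtls.infix {C C' : List (ℕ × ℕ)} (h : ContainsBtls n m p q C) (h' : C' <:+: C) :
    ContainsBtls n m p q C' := by
  obtain ⟨a, b, rfl⟩ := h'
  rintro l₁ u s v l₂ rfl
  exact h (a ++ l₁) u s v (l₂ ++ b) (by simp)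

theorem IsLocallyOptimal.containsBtls {C : List (ℕ × ℕ)} (hC : GridPath n m C z z')
    (hw : ∀ i j i' j' : ℕ, i < n → j < m → i' < n → j' < m →
      dist (p i) (q j) = dist (p i') (q j') → (i, j) = (i', j'))
    (h : IsLocallyOptimal n m (fun y => dist (p y.1) (q y.2)) C) : ContainsBtls n m p q C := by
  intro l₁ u s v l₂ hdec hs x ⟨l, hl, hne, hx, hlw, hxw⟩
  have hsub := (hdec ▸ hC).subpath
  have hint : (u :: (s ++ [v])).tail.dropLast = s := by simp
  obtain ⟨y, hy, hyw⟩ := exists_mem_eq_innerWidth (p := p) (q := q) (hint.symm ▸ hs)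
  rw [hint] at hy
  have hge : dGrid n m p q u v ≤ dist (p y.1) (q y.2) := hyw ▸ dGrid_le hsub (hint.symm ▸ hs)
  have hl' := hl
  rw [hl.eq_cons_of_tail_dropLast_ne_nil hne] at hl'
  obtain ⟨x', hx', hle⟩ := h l₁ u s v l₂ _ hdec hl' y hy
  have heq : dist (p x.1) (q x.2) = dist (p y.1) (q y.2) := by
    refine le_antisymm (hxw ▸ hge) ?_
    rw [hxw, ← hlw]
    exact hle.trans (le_innerWidth hx')
  have hxb := hl.2.2.2 x (List.mem_of_mem_tail (List.mem_of_mem_dropLast hx))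
  have hyb := hsub.2.2.2 y (by simp [hy])
  have : x = y := hw _ _ _ _ hxb.1 hxb.2 hyb.1 hyb.2 heq
  exact this ▸ hy

theorem ContainsBtls.eq_of_gridPath {u v : ℕ × ℕ} {s s' : List (ℕ × ℕ)}
    (h : GridPath n m (u :: (s ++ [v])) u v) (h' : GridPath n m (u :: (s' ++ [v])) u v)
    (hs : ContainsBtls n m p q (u :: (s ++ [v]))) (hs' : ContainsBtls n m p q (u :: (s' ++ [v]))) :
    s = s' := by
  have hlen : s.length = s'.length := by simpa using h.length_eq h'
  by_cases hnil : s = []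
  · subst hnil
    exact (List.length_eq_zero_iff.1 hlen.symm).symm
  have hnil' : s' ≠ [] := by rintro rfl; exact hnil (List.length_eq_zero_iff.1 hlen)
  obtain ⟨x, hx⟩ := exists_isBtl (p := p) (q := q) h (by simpa using hnil)
  have hxs := hs [] u s v [] rfl hnil x hx
  have hxs' := hs' [] u s' v [] rfl hnil' x hx
  obtain ⟨a, b, rfl⟩ := List.append_of_mem hxs
  obtain ⟨a', b', rfl⟩ := List.append_of_mem hxs'
  have hsplit : ∀ a b : List (ℕ × ℕ), u :: (a ++ x :: b ++ [v]) = u :: a ++ x :: (b ++ [v]) := by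
    simp
  rw [hsplit] at h h' hs hs'
  obtain ⟨h1, h2⟩ := gridPath_append_cons_iff.1 h
  obtain ⟨h1', h2'⟩ := gridPath_append_cons_iff.1 h'
  have hleft : a = a' := ContainsBtls.eq_of_gridPath h1 h1'
    (hs.infix ⟨[], b ++ [v], by simp⟩) (hs'.infix ⟨[], b' ++ [v], by simp⟩)
  have hright : b = b' := ContainsBtls.eq_of_gridPath h2 h2'
    (hs.infix ⟨u :: a, [], by simp⟩) (hs'.infix ⟨u :: a', [], by simp⟩)
  rw [hleft, hright]
termination_by s.length
decreasing_by all_goals (subst_vars; simp; try omega)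

theorem List.exists_eq_append_cons_append_cons {α : Type*} {C : List α} {a b : ℕ} (e : α)
    (hab : a < b) (hb : b < C.length) : ∃ l₁ s l₂, C = l₁ ++ C.getD a e :: (s ++ C.getD b e :: l₂) ∧
      l₁.length = a ∧ s.length + a + 1 = b := by
  refine ⟨C.take a, (C.drop (a + 1)).take (b - a - 1), C.drop (b + 1), ?_, ?_, ?_⟩
  · have ha : a < C.length := hab.trans hb
    rw [List.getD_eq_getElem _ _ ha, List.getD_eq_getElem _ _ hb, List.getElem_cons_drop]
    conv_lhs => rw [← List.take_append_drop a C, ← List.getElem_cons_drop ha,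
      ← List.take_append_drop (b - a - 1) (C.drop (a + 1)), List.drop_drop]
    rw [show a + 1 + (b - a - 1) = b by omega]
  · simp; omega
  · simp; omega

theorem List.take_drop_append_cons_append_cons {α : Type*} (l₁ s l₂ : List α) (u v : α) :
    ((l₁ ++ u :: (s ++ v :: l₂)).drop l₁.length).take (s.length + 2) = u :: (s ++ [v]) := by
  rw [List.drop_left, List.take_succ_cons, List.take_length_add_append]
  simp

theorem isRetractableMorphing_iff_containsBtls {C : List (ℕ × ℕ)} (hC : GridPath n m C z z') :
    IsRetractableMorphing n m p q C ↔ ContainsBtls n m p q C := by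
  have hsub : ∀ {l₁ u s v l₂}, C = l₁ ++ u :: (s ++ v :: l₂) →
      GridPath n m (u :: (s ++ [v])) u v := by
    rintro l₁ u s v l₂ rfl
    exact hC.subpath
  constructor
  · intro h l₁ u s v l₂ hdec hs x hx
    have h1 : C.getD l₁.length (0, 0) = u := by simp [hdec]
    have h2 : C.getD (l₁.length + (s.length + 1)) (0, 0) = v := by simp [hdec]
    have := h l₁.length (l₁.length + (s.length + 1)) (by omega) (by simp [hdec])
      (by rw [h1, h2]; exact fun l hl => (hsub hdec).tail_dropLast_ne_nil hs hl) x
      (by rwa [h1, h2])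
    rw [hdec, show l₁.length + (s.length + 1) - l₁.length + 1 = s.length + 2 by omega,
      List.take_drop_append_cons_append_cons] at this
    have := hx.ne
    simp_all
  · intro h a b hab hb hne x hx
    obtain ⟨l₁, s, l₂, hdec, h1, h2⟩ := List.exists_eq_append_cons_append_cons (0, 0) hab hb
    generalize C.getD a (0, 0) = u at *
    generalize C.getD b (0, 0) = v at *
    have hs : s ≠ [] := by simpa using hne _ (hsub hdec)
    have hxs := h l₁ u s v l₂ hdec hs x hx
    rw [hdec, ← h1, show b - l₁.length + 1 = s.length + 2 by omega,
      List.take_drop_append_cons_append_cons]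
    simp [hxs]

theorem ContainsBtls.gridPath_unique {C C' : List (ℕ × ℕ)}
    (h : GridPath n m C z z') (h' : GridPath n m C' z z')
    (hC : ContainsBtls n m p q C) (hC' : ContainsBtls n m p q C') : C = C' := by
  have hlen := h.length_eq h'
  by_cases hnil : C.tail.dropLast = []
  · have hnil' : C'.tail.dropLast = [] := by
      rw [← List.length_eq_zero_iff] at hnil ⊢
      simp at hnil ⊢
      omega
    obtain ⟨h1, h2, -⟩ := h
    obtain ⟨h1', h2', -⟩ := h'
    match C, C' with
    | [], [] => rfl
    | [a], [b] => simp_all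
    | [a, b], [c, e] => simp_all
    | _ :: _ :: _ :: _, _ => simp at hnil
    | _, _ :: _ :: _ :: _ => simp at hnil'
  · have hnil' : C'.tail.dropLast ≠ [] := by
      rw [← ne_eq, ← List.length_pos_iff] at hnil
      rw [← List.length_pos_iff]
      simp at hnil ⊢
      omega
    have e := h.eq_cons_of_tail_dropLast_ne_nil hnil
    have e' := h'.eq_cons_of_tail_dropLast_ne_nil hnil'
    rw [e] at h hC ⊢
    rw [e'] at h' hC' ⊢
    rw [ContainsBtls.eq_of_gridPath h h' hC hC']

end Width

end GridPaths

/-- If all the pairwise distances `dist (p i) (q j)`,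
`(i,j) ∈ {0,…,n−1} × {0,…,m−1}`, are distinct, then there is exactly one retractable
discrete Fréchet morphing between the two point sequences. -/
theorem retractable_discrete_frechet_unique (d n m : ℕ) (hn : 1 ≤ n) (hm : 1 ≤ m)
    (p q : ℕ → EuclideanSpace ℝ (Fin d))
    (hdist : ∀ i j i' j' : ℕ, i < n → j < m → i' < n → j' < m →
      dist (p i) (q j) = dist (p i') (q j') → (i, j) = (i', j')) :
    ∃! C : List (ℕ × ℕ), IsDiscreteMorphing n m C ∧ IsRetractableMorphing n m p q C := by
  obtain ⟨C, hC, hopt⟩ := exists_isLocallyOptimal (w := fun y => dist (p y.1) (q y.2))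
    (fun a b h1 h2 h3 h4 hab => hdist _ _ _ _ h1 h2 h3 h4 hab)
    (exists_gridPath (n - 1) (m - 1) (Nat.sub_lt hn one_pos) (Nat.sub_lt hm one_pos))
  have hbtl := hopt.containsBtls hC hdist
  refine ⟨C, ⟨hC, (isRetractableMorphing_iff_containsBtls hC).2 hbtl⟩, fun C' hC' => ?_⟩
  exact ContainsBtls.gridPath_unique hC'.1 hC
    ((isRetractableMorphing_iff_containsBtls hC'.1).1 hC'.2) hbtl
end

section
/- Let δ > 0 and let A be the polygonal curve with vertices p_1,…,p_n ∈ ℝ^d. Let 1 = i_1 < i_2 < ⋯ < i_k = n be indices such that for every t < k and every j with i_t < j < i_{t+1}, one has ‖p_j − p_{i_t}‖ ≤ δ. Let Ā be the polygonal curve with vertices p_{i_1}, p_{i_2}, …, p_{i_k}. Then d_F(A, Ā) ≤ δ. -/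
open Set

/-- A weakly monotone continuous surjective reparameterization of `[0,1]`. -/
def Reparam (φ : ℝ → ℝ) : Prop :=
  ContinuousOn φ (Set.Icc 0 1) ∧ MonotoneOn φ (Set.Icc 0 1) ∧
    φ '' Set.Icc 0 1 = Set.Icc 0 1

/-- The (continuous, monotone) Fréchet distance between two curves parameterized
over `[0,1]`. -/
noncomputable def frechetDist {V : Type*} [NormedAddCommGroup V] [NormedSpace ℝ V]
    (f g : ℝ → V) : ℝ :=
  sInf { r | ∃ φ ψ, Reparam φ ∧ Reparam ψ ∧
    r = sSup ((fun t => ‖f (φ t) - g (ψ t)‖) '' Set.Icc (0 : ℝ) 1) }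

/-- The polygonal curve through the vertices `p 0, …, p n`, parameterized over `[0,1]`
(with each of the `n` edges traversed on a parameter interval of length `1/n`). -/
noncomputable def polyCurve {V : Type*} [NormedAddCommGroup V] [NormedSpace ℝ V]
    {n : ℕ} (p : Fin (n + 1) → V) : ℝ → V := fun t =>
  let s := t * n
  let i := min ⌊s⌋₊ (n - 1)
  (1 - (s - (i : ℝ))) • p ⟨i, Nat.lt_succ_of_le ((min_le_right _ _).trans (Nat.sub_le _ _))⟩ +
    (s - (i : ℝ)) • p ⟨min (i + 1) n, Nat.lt_succ_of_le (min_le_right _ _)⟩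

/-- A point of a polygonal curve on its `j`-th edge is the corresponding affine combination of
the two end vertices of that edge. -/
theorem polyCurve_eq_of_mem_edge {V : Type*} [NormedAddCommGroup V] [NormedSpace ℝ V] {n : ℕ}
    (p : Fin (n + 1) → V) (j : Fin n) {t u : ℝ} (hu0 : 0 ≤ u) (hu1 : u ≤ 1)
    (ht : t * n = j + u) :
    polyCurve p t = (1 - u) • p j.castSucc + u • p j.succ := by
  obtain ⟨j, hj⟩ := j
  simp only [polyCurve, ht]
  rcases hu1.lt_or_eq with hu | rfl
  · have hfl : ⌊(j : ℝ) + u⌋₊ = j := by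
      rw [Nat.floor_eq_iff (by positivity)]
      constructor <;> linarith
    have h1 : min j (n - 1) = j := by omega
    have h2 : min (j + 1) n = j + 1 := by omega
    simp [hfl, h1, h2]
  · have hfl : ⌊(j : ℝ) + 1⌋₊ = j + 1 := by exact_mod_cast Nat.floor_natCast (R := ℝ) (j + 1)
    by_cases hjn : j + 1 = n
    · have h1 : min (j + 1) (n - 1) = j := by omega
      have h2 : min (j + 1) n = j + 1 := by omega
      simp [hfl, h1, h2]
    · have h1 : min (j + 1) (n - 1) = j + 1 := by omega
      simp [hfl, h1]

/-- Every point of `[0, 1]` lies on one of the `n` parameter intervals of length `1 / n`. -/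
theorem exists_edge_of_mem_Icc {n : ℕ} (hn : 0 < n) {t : ℝ} (ht : t ∈ Icc (0 : ℝ) 1) :
    ∃ (j : Fin n) (u : ℝ), 0 ≤ u ∧ u ≤ 1 ∧ t * n = j + u := by
  have hn' : (0 : ℝ) < n := by exact_mod_cast hn
  rcases ht.2.lt_or_eq with h | rfl
  · have h0 : 0 ≤ t * n := mul_nonneg ht.1 hn'.le
    refine ⟨⟨⌊t * n⌋₊, (Nat.floor_lt h0).2 (by nlinarith)⟩, t * n - ⌊t * n⌋₊, ?_, ?_, by simp⟩
    · linarith [Nat.floor_le h0]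
    · linarith [Nat.lt_floor_add_one (t * n)]
  · refine ⟨⟨n - 1, by omega⟩, 1, zero_le_one, le_rfl, ?_⟩
    have : ((n - 1 : ℕ) : ℝ) + 1 = n := by exact_mod_cast Nat.sub_add_cancel hn
    simp [this]

theorem reparam_of_endpoints {φ : ℝ → ℝ} (hc : Continuous φ) (hm : Monotone φ)
    (h0 : φ 0 = 0) (h1 : φ 1 = 1) : Reparam φ := by
  refine ⟨hc.continuousOn, hm.monotoneOn _, Subset.antisymm ?_ ?_⟩
  · rintro _ ⟨t, ht, rfl⟩
    exact ⟨h0 ▸ hm ht.1, h1 ▸ hm ht.2⟩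
  · simpa [h0, h1] using intermediate_value_Icc zero_le_one hc.continuousOn

theorem frechetDist_le_of_reparam {V : Type*} [NormedAddCommGroup V] [NormedSpace ℝ V]
    {f g : ℝ → V} {φ ψ : ℝ → ℝ} {δ : ℝ} (hφ : Reparam φ) (hψ : Reparam ψ)
    (h : ∀ t ∈ Icc (0 : ℝ) 1, ‖f (φ t) - g (ψ t)‖ ≤ δ) : frechetDist f g ≤ δ := by
  unfold frechetDist
  refine csInf_le_of_le ⟨0, ?_⟩ ⟨φ, ψ, hφ, hψ, rfl⟩ (csSup_le ?_ ?_)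
  · rintro _ ⟨_, _, -, -, rfl⟩
    refine Real.sSup_nonneg ?_
    rintro _ ⟨t, -, rfl⟩
    exact norm_nonneg _
  · exact (nonempty_Icc.2 zero_le_one).image _
  · rintro _ ⟨t, ht, rfl⟩
    exact h t ht

/-- The parameter matching the curve through `p` with its simplification through `p ∘ ι`: it
rests at each kept vertex and traverses an edge of the simplification while the original curve
traverses its last edge before the next kept vertex. -/
noncomputable def restThenMove {n k : ℕ} (ι : Fin (k + 1) → Fin (n + 1)) (t : ℝ) : ℝ :=
  (∑ a : Fin k, max 0 (min 1 (t * n - ((ι a.succ : ℕ) - 1)))) / k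

theorem exists_between_kept {n k : ℕ} {ι : Fin (k + 1) → Fin (n + 1)}
    (h0 : ι 0 = 0) (hlast : ι (Fin.last k) = Fin.last n) (j : Fin n) :
    ∃ a : Fin k, ι a.castSucc ≤ j.castSucc ∧ j.castSucc < ι a.succ := by
  by_contra! h
  have key : ∀ a, ι a ≤ j.castSucc := by
    intro a
    induction a using Fin.induction with
    | zero => simp [h0]
    | succ a ih => exact h a ih
  exact absurd (key (Fin.last k)) (by rw [hlast]; exact not_le.2 (Fin.castSucc_lt_last j))

theorem restThenMove_mul {n k : ℕ} {ι : Fin (k + 1) → Fin (n + 1)} (hι : StrictMono ι)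
    {j : Fin n} {a : Fin k} (ha : ι a.castSucc ≤ j.castSucc) (ha' : j.castSucc < ι a.succ)
    {t u : ℝ} (hu0 : 0 ≤ u) (hu1 : u ≤ 1) (ht : t * n = j + u) :
    restThenMove ι t * k = a + max 0 (min 1 (j + u - ((ι a.succ : ℕ) - 1))) := by
  have hk : (k : ℝ) ≠ 0 := by exact_mod_cast (Fin.pos a).ne'
  rw [restThenMove, div_mul_cancel₀ _ hk, ht]
  have hterm : ∀ b : Fin k, max 0 (min 1 ((j : ℝ) + u - ((ι b.succ : ℕ) - 1))) =
      (if b < a then 1 else 0) +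
        if b = a then max 0 (min 1 ((j : ℝ) + u - ((ι a.succ : ℕ) - 1))) else 0 := by
    intro b
    rcases lt_trichotomy b a with hb | rfl | hb
    · have h1 : ι b.succ ≤ j.castSucc := (hι.monotone (Fin.succ_le_castSucc_iff.2 hb)).trans ha
      have h2 : ((ι b.succ : ℕ) : ℝ) ≤ j := by exact_mod_cast h1
      rw [min_eq_left (by linarith)]
      simp [hb, hb.ne]
    · simp
    · have h1 : ι a.succ < ι b.succ := hι (Fin.succ_lt_succ_iff.2 hb)
      have h3 : (j : ℕ) + 2 ≤ (ι b.succ : ℕ) := by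
        have := Fin.lt_def.1 h1
        have := Fin.lt_def.1 ha'
        simp only [Fin.val_castSucc] at this
        omega
      have h2 : (j : ℝ) + 2 ≤ ((ι b.succ : ℕ) : ℝ) := by exact_mod_cast h3
      rw [max_eq_left (min_le_of_right_le (by linarith))]
      simp [hb.ne', hb.not_gt]
  rw [Finset.sum_congr rfl fun b _ => hterm b, Finset.sum_add_distrib]
  simp [Finset.filter_gt_eq_Iio]

theorem restThenMove_reparam {n k : ℕ} {ι : Fin (k + 1) → Fin (n + 1)} (hι : StrictMono ι)
    (h0 : ι 0 = 0) (hk : 0 < k) : Reparam (restThenMove ι) := by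
  have hk' : (k : ℝ) ≠ 0 := by exact_mod_cast hk.ne'
  refine reparam_of_endpoints (by unfold restThenMove; fun_prop) ?_ ?_ ?_
  · intro s t hst
    unfold restThenMove
    gcongr
  · have hpos (a : Fin k) : (1 : ℝ) ≤ (ι a.succ : ℕ) := by
      have h := hι (Fin.succ_pos a)
      rw [h0] at h
      exact_mod_cast Fin.lt_def.1 h
    rw [restThenMove, Finset.sum_eq_zero, zero_div]
    intro a _
    exact max_eq_left (min_le_of_right_le (by linarith [hpos a]))
  · have hle (a : Fin k) : ((ι a.succ : ℕ) : ℝ) ≤ n := by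
      exact_mod_cast Nat.lt_succ_iff.1 (ι a.succ).2
    rw [restThenMove, Finset.sum_eq_card_nsmul (b := 1)]
    · simp [hk']
    · intro a _
      rw [min_eq_left (by linarith [hle a])]
      simp

/-- The greedy `δ`-simplification (keeping a subsequence of vertices
such that all skipped vertices are within distance `δ` of the preceding kept vertex)
is within Fréchet distance `δ` of the original polygonal curve. -/
theorem frechet_of_delta_simplification (d n k : ℕ) (δ : ℝ) (hδ : 0 < δ)
    (p : Fin (n + 1) → EuclideanSpace ℝ (Fin d))
    (ι : Fin (k + 1) → Fin (n + 1)) (hι : StrictMono ι)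
    (h0 : ι 0 = 0) (hlast : ι (Fin.last k) = Fin.last n)
    (hclose : ∀ (a : Fin k) (j : Fin (n + 1)),
      ι a.castSucc < j → j < ι a.succ → ‖p j - p (ι a.castSucc)‖ ≤ δ) :
    frechetDist (polyCurve p) (polyCurve (p ∘ ι)) ≤ δ := by
  rcases Nat.eq_zero_or_pos n with rfl | hn
  · have hid : Reparam fun t => t := reparam_of_endpoints continuous_id monotone_id rfl rfl
    have hk : k = 0 := by
      have := Fintype.card_le_of_injective ι hι.injective
      simpa using this
    subst hk
    refine frechetDist_le_of_reparam hid hid fun t _ => ?_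
    simp [polyCurve, h0, hδ.le]
  have hk : 0 < k := by
    rcases Nat.eq_zero_or_pos k with rfl | hk
    · have h : (0 : Fin (n + 1)) = Fin.last n := h0.symm.trans hlast
      simp [Fin.ext_iff] at h
      omega
    · exact hk
  refine frechetDist_le_of_reparam (φ := fun t => t)
    (reparam_of_endpoints continuous_id monotone_id rfl rfl)
    (restThenMove_reparam hι h0 hk) fun t ht => ?_
  obtain ⟨j, u, hu0, hu1, htj⟩ := exists_edge_of_mem_Icc hn ht
  obtain ⟨a, ha, ha'⟩ := exists_between_kept h0 hlast j
  have hball (i : Fin (n + 1)) (hi : ι a.castSucc ≤ i) (hi' : i < ι a.succ) :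
      ‖p i - p (ι a.castSucc)‖ ≤ δ := by
    rcases hi.lt_or_eq with hlt | rfl
    · exact hclose a i hlt hi'
    · simpa using hδ.le
  rw [polyCurve_eq_of_mem_edge p j hu0 hu1 htj,
    polyCurve_eq_of_mem_edge (p ∘ ι) a (le_max_left _ _) (max_le zero_le_one (min_le_left _ _))
      (restThenMove_mul hι ha ha' hu0 hu1 htj)]
  have hj := hball _ ha ha'
  have hsucc : j.succ ≤ ι a.succ := Fin.castSucc_lt_iff_succ_le.1 ha'
  rcases hsucc.lt_or_eq with hlt | heq
  · have hj' := hball _ (ha.trans (Fin.castSucc_le_succ j)) hlt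
    have hlt' : (j : ℝ) + 2 ≤ ((ι a.succ : ℕ) : ℝ) := by exact_mod_cast Fin.lt_def.1 hlt
    rw [max_eq_left (min_le_of_right_le (by linarith))]
    simp only [Function.comp_apply, sub_zero, one_smul, zero_smul, add_zero]
    rw [← mem_closedBall_iff_norm] at hj hj' ⊢
    exact convex_closedBall _ _ hj hj' (by linarith) hu0 (by ring)
  · have hc : (j : ℝ) + u - ((ι a.succ : ℕ) - 1) = u := by
      rw [← heq]
      push_cast [Fin.val_succ]
      ring
    rw [hc, min_eq_right hu1, max_eq_right hu0, Function.comp_apply, Function.comp_apply, ← heq,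
      add_sub_add_right_eq_sub, ← smul_sub, norm_smul, Real.norm_of_nonneg (by linarith)]
    exact (mul_le_of_le_one_left (norm_nonneg _) (by linarith)).trans hj
end

section
/- Let δ > 0 and let A be a polygonal curve with vertices p_1,…,p_n ∈ ℝ^d (n ≥ 2, p_1 ≠ p_n) such that ‖p_j − p_1‖ ≤ δ for all 1 ≤ j ≤ n−1. Let A : [0,L] → ℝ^d be the uniform (arc-length) parameterization of A, and let s : [0, ‖p_n − p_1‖] → ℝ^d be the uniform parameterization of the segment from p_1 to p_n. For t ∈ [0,L], let f(t) be the parameter of the (unique) nearest point to A(t) on the segment, and let F(t) = max_{τ ∈ [0,t]} f(τ). Then F(0) = 0, F(L) = ‖p_n − p_1‖, and sup_{t ∈ [0,L]} ‖A(t) − s(F(t))‖ ≤ 2δ; consequently d_F(A, s) ≤ 2δ. -/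
open Set

/-- The vertices of a polygonal curve, extended to an `ℕ`-indexed family by clamping. -/
def pext {d n : ℕ} (p : Fin (n + 1) → EuclideanSpace ℝ (Fin d)) :
    ℕ → EuclideanSpace ℝ (Fin d) :=
  fun j => p ⟨min j n, Nat.lt_succ_of_le (min_le_right _ _)⟩

/-- `cum p i` is the arc length of the polygonal curve `p` up to its `i`-th vertex;
`cum p n` is its total length. -/
noncomputable def cum {d n : ℕ} (p : Fin (n + 1) → EuclideanSpace ℝ (Fin d)) (i : ℕ) : ℝ :=
  ∑ j ∈ Finset.range (min i n), dist (pext p j) (pext p (j + 1))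

/-- `A : [0, cum p n] → ℝ^d` is the uniform (arc-length) parameterization of the polygonal
curve with vertices `p 0, …, p n`. -/
def IsArcParam {d n : ℕ} (p : Fin (n + 1) → EuclideanSpace ℝ (Fin d))
    (A : ℝ → EuclideanSpace ℝ (Fin d)) : Prop :=
  ∀ i < n, ∀ x ∈ Set.Icc (cum p i) (cum p (i + 1)),
    A x = pext p i +
      ((x - cum p i) / dist (pext p i) (pext p (i + 1))) • (pext p (i + 1) - pext p i)

/-- The uniform parameterization `[0, dist a b] → ℝ^d` of the segment from `a` to `b`. -/
noncomputable def segParam {d : ℕ} (a b : EuclideanSpace ℝ (Fin d)) :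
    ℝ → EuclideanSpace ℝ (Fin d) :=
  fun x => a + (x / dist a b) • (b - a)

/-- The running maximum `F(t) = max_{τ ∈ [0,t]} f(τ)`. -/
noncomputable def runMax (f : ℝ → ℝ) (t : ℝ) : ℝ := sSup (f '' Set.Icc 0 t)

section RunningMaximum

variable {f : ℝ → ℝ} {L : ℝ}

theorem bddAbove_image_Icc_zero (hf : ContinuousOn f (Icc 0 L)) {t : ℝ} (ht : t ≤ L) :
    BddAbove (f '' Icc 0 t) :=
  (isCompact_Icc.image_of_continuousOn (hf.mono (Icc_subset_Icc_right ht))).bddAbove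

theorem le_runMax (hf : ContinuousOn f (Icc 0 L)) {τ t : ℝ} (hτ : 0 ≤ τ) (hτt : τ ≤ t)
    (ht : t ≤ L) : f τ ≤ runMax f t :=
  le_csSup (bddAbove_image_Icc_zero hf ht) ⟨τ, ⟨hτ, hτt⟩, rfl⟩

theorem runMax_le {t c : ℝ} (ht : 0 ≤ t) (h : ∀ τ ∈ Icc 0 t, f τ ≤ c) : runMax f t ≤ c := by
  refine csSup_le ((nonempty_Icc.2 ht).image f) ?_
  rintro _ ⟨τ, hτ, rfl⟩
  exact h τ hτ

theorem runMax_zero : runMax f 0 = f 0 := by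
  simp [runMax]

theorem runMax_monotoneOn (hf : ContinuousOn f (Icc 0 L)) : MonotoneOn (runMax f) (Icc 0 L) :=
  fun _ hx _ hy hxy => runMax_le hx.1 fun _ hτ => le_runMax hf hτ.1 (hτ.2.trans hxy) hy.2

theorem runMax_continuousOn (hf : ContinuousOn f (Icc 0 L)) :
    ContinuousOn (runMax f) (Icc 0 L) := by
  intro t₀ ht₀
  have hL : 0 ≤ L := ht₀.1.trans ht₀.2
  have hext : Continuous (IccExtend hL ((Icc 0 L).domRestrict f)) :=
    hf.domRestrict.Icc_extend'
  have hsup : Continuous fun t : ℝ =>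
      sSup ((fun x => IccExtend hL ((Icc 0 L).domRestrict f) (x * t)) '' Icc (0 : ℝ) 1) :=
    isCompact_Icc.continuous_sSup
      (f := fun t x : ℝ => IccExtend hL ((Icc 0 L).domRestrict f) (x * t))
      (hext.comp (continuous_snd.mul continuous_fst))
  refine (hsup.continuousOn.congr fun t ht => ?_) t₀ ht₀
  have himg : Icc 0 t = (fun x => x * t) '' Icc (0 : ℝ) 1 := by
    rw [image_mul_right_Icc zero_le_one ht.1, zero_mul, one_mul]
  rw [runMax, himg, image_image]
  congr 1
  refine image_congr fun x hx => ?_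
  have hxt : x * t ∈ Icc 0 L :=
    ⟨mul_nonneg hx.1 ht.1, (mul_le_of_le_one_left ht.1 hx.2).trans ht.2⟩
  rw [IccExtend_of_mem hL _ hxt, domRestrict_apply]

theorem reparam_runMax {D : ℝ} (hL : 0 ≤ L) (hD : 0 < D) (hf : ContinuousOn f (Icc 0 L))
    (h₀ : runMax f 0 = 0) (h₁ : runMax f L = D) :
    Reparam fun u => runMax f (u * L) / D := by
  have hmaps : MapsTo (fun u => u * L) (Icc (0 : ℝ) 1) (Icc 0 L) := fun u hu =>
    ⟨mul_nonneg hu.1 hL, mul_le_of_le_one_left hL hu.2⟩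
  have hcont : ContinuousOn (fun u => runMax f (u * L) / D) (Icc (0 : ℝ) 1) :=
    ((runMax_continuousOn hf).comp (by fun_prop) hmaps).div_const D
  have hmono : MonotoneOn (fun u => runMax f (u * L) / D) (Icc (0 : ℝ) 1) := by
    intro x hx y hy hxy
    have := runMax_monotoneOn hf (hmaps hx) (hmaps hy) (mul_le_mul_of_nonneg_right hxy hL)
    exact div_le_div_of_nonneg_right this hD.le
  refine ⟨hcont, hmono, Subset.antisymm ?_ ?_⟩
  · refine (hmono.image_Icc_subset).trans ?_
    simp [h₀, h₁, hD.ne']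
  · have := intermediate_value_Icc zero_le_one hcont
    simpa [h₀, h₁, hD.ne'] using this

end RunningMaximum

theorem reparam_id : Reparam fun u => u :=
  ⟨continuousOn_id, monotoneOn_id, image_id _⟩

theorem frechetDist_le {V : Type*} [NormedAddCommGroup V] [NormedSpace ℝ V] {f g : ℝ → V}
    {φ ψ : ℝ → ℝ} {r : ℝ} (hφ : Reparam φ) (hψ : Reparam ψ)
    (h : ∀ t ∈ Icc (0 : ℝ) 1, ‖f (φ t) - g (ψ t)‖ ≤ r) : frechetDist f g ≤ r := by
  refine csInf_le_of_le (b := sSup ((fun t => ‖f (φ t) - g (ψ t)‖) '' Icc (0 : ℝ) 1))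
    ⟨0, ?_⟩ ⟨φ, ψ, hφ, hψ, rfl⟩ (csSup_le ?_ ?_)
  · rintro _ ⟨φ', ψ', -, -, rfl⟩
    refine Real.sSup_nonneg ?_
    rintro _ ⟨t, -, rfl⟩
    exact norm_nonneg _
  · exact (nonempty_Icc.2 zero_le_one).image _
  · rintro _ ⟨t, ht, rfl⟩
    exact h t ht

section Segment

variable {d : ℕ} {a b : EuclideanSpace ℝ (Fin d)}

/-- The signed coordinate of `v` along the line from `a` to `b`, measured from `a`. -/
noncomputable def axisCoord (a b v : EuclideanSpace ℝ (Fin d)) : ℝ :=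
  inner ℝ (v - a) (b - a) / dist a b

theorem continuous_axisCoord : Continuous (axisCoord a b) := by
  unfold axisCoord
  fun_prop

theorem axisCoord_left : axisCoord a b a = 0 := by
  simp [axisCoord]

theorem axisCoord_right : axisCoord a b b = dist a b := by
  rw [axisCoord, real_inner_self_eq_norm_sq, dist_comm, dist_eq_norm, sq, mul_self_div_self]

theorem axisCoord_le_dist (v : EuclideanSpace ℝ (Fin d)) : axisCoord a b v ≤ dist v a := by
  refine div_le_of_le_mul₀ dist_nonneg dist_nonneg ?_
  rw [dist_eq_norm v, dist_comm, dist_eq_norm]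
  exact real_inner_le_norm _ _

theorem axisCoord_lineMap (v w : EuclideanSpace ℝ (Fin d)) (c : ℝ) :
    axisCoord a b (AffineMap.lineMap v w c) =
      axisCoord a b v + c * (axisCoord a b w - axisCoord a b v) := by
  have h : AffineMap.lineMap v w c - a = (v - a) + c • ((w - a) - (v - a)) := by
    rw [AffineMap.lineMap_apply_module']
    module
  rw [axisCoord, h, inner_add_left, real_inner_smul_left, inner_sub_left (w - a)]
  simp only [axisCoord]
  ring

theorem dist_segParam_sq (hab : a ≠ b) (v : EuclideanSpace ℝ (Fin d)) (y : ℝ) :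
    dist v (segParam a b y) ^ 2 =
      (y - axisCoord a b v) ^ 2 + (dist v a ^ 2 - axisCoord a b v ^ 2) := by
  have hD : dist a b ≠ 0 := dist_ne_zero.2 hab
  have hb : ‖b - a‖ = dist a b := by rw [dist_comm, dist_eq_norm]
  have h : v - segParam a b y = (v - a) - (y / dist a b) • (b - a) := by
    rw [segParam]
    abel
  rw [dist_eq_norm, h, norm_sub_sq_real, norm_smul, real_inner_smul_right, mul_pow, hb,
    ← dist_eq_norm, Real.norm_eq_abs, sq_abs, axisCoord]
  field_simp
  ring

theorem dist_segParam_segParam (hab : a ≠ b) (x y : ℝ) :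
    dist (segParam a b x) (segParam a b y) = |x - y| := by
  have hD : dist a b ≠ 0 := dist_ne_zero.2 hab
  have h : segParam a b x - segParam a b y = ((x - y) / dist a b) • (b - a) := by
    simp only [segParam]
    module
  rw [dist_eq_norm, h, norm_smul, ← dist_eq_norm b, dist_comm b, Real.norm_eq_abs, abs_div,
    abs_of_nonneg (dist_nonneg (x := a) (y := b)), div_mul_cancel₀ _ hD]

theorem segParam_zero : segParam a b 0 = a := by
  simp [segParam]

theorem segParam_mul_dist (hab : a ≠ b) (c : ℝ) :
    segParam a b (c * dist a b) = AffineMap.lineMap a b c := by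
  rw [segParam, mul_div_cancel_right₀ _ (dist_ne_zero.2 hab), AffineMap.lineMap_apply_module',
    add_comm]

theorem nearest_eq_clamp (hab : a ≠ b) {v : EuclideanSpace ℝ (Fin d)} {x : ℝ}
    (hx : x ∈ Icc 0 (dist a b))
    (hmin : ∀ y ∈ Icc 0 (dist a b), dist v (segParam a b x) ≤ dist v (segParam a b y)) :
    x = max 0 (min (dist a b) (axisCoord a b v)) := by
  have hD : (0 : ℝ) ≤ dist a b := dist_nonneg
  have key : ∀ y ∈ Icc 0 (dist a b), (x - axisCoord a b v) ^ 2 ≤ (y - axisCoord a b v) ^ 2 := by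
    intro y hy
    have := pow_le_pow_left₀ dist_nonneg (hmin y hy) 2
    rw [dist_segParam_sq hab, dist_segParam_sq hab] at this
    linarith
  obtain ⟨hx₀, hx₁⟩ := hx
  generalize axisCoord a b v = g at *
  rcases le_total g 0 with h | h
  · rw [min_eq_right (h.trans hD), max_eq_left h]
    have := key 0 ⟨le_rfl, hD⟩
    nlinarith
  · rcases le_total g (dist a b) with h' | h'
    · rw [min_eq_right h', max_eq_right h]
      have := key g ⟨h, h'⟩
      nlinarith
    · rw [min_eq_left h', max_eq_right hD]
      have := key _ ⟨hD, le_rfl⟩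
      nlinarith

end Segment

section ArcLength

variable {d n : ℕ} {p : Fin (n + 1) → EuclideanSpace ℝ (Fin d)}
  {A : ℝ → EuclideanSpace ℝ (Fin d)}

theorem cum_zero : cum p 0 = 0 := by
  simp [cum]

theorem cum_succ {i : ℕ} (hi : i < n) :
    cum p (i + 1) = cum p i + dist (pext p i) (pext p (i + 1)) := by
  rw [cum, cum, min_eq_left hi.le, min_eq_left (Nat.succ_le_of_lt hi), Finset.sum_range_succ]

theorem cum_le_cum_succ {i : ℕ} (hi : i < n) : cum p i ≤ cum p (i + 1) := by
  rw [cum_succ hi]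
  exact le_add_of_nonneg_right dist_nonneg

theorem cum_nonneg (i : ℕ) : 0 ≤ cum p i :=
  Finset.sum_nonneg fun _ _ => dist_nonneg

theorem pext_zero : pext p 0 = p 0 := by
  simp [pext]

theorem pext_self : pext p n = p (Fin.last n) := by
  simp [pext, Fin.last]

/-- The affine parameter on the `i`-th edge at arc length `x`. -/
noncomputable def edgeParam (p : Fin (n + 1) → EuclideanSpace ℝ (Fin d)) (i : ℕ) (x : ℝ) : ℝ :=
  (x - cum p i) / dist (pext p i) (pext p (i + 1))

theorem edgeParam_mono (i : ℕ) : Monotone (edgeParam p i) := fun _ _ h =>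
  div_le_div_of_nonneg_right (sub_le_sub_right h _) dist_nonneg

theorem continuous_edgeParam (i : ℕ) : Continuous (edgeParam p i) := by
  unfold edgeParam
  fun_prop

theorem edgeParam_mem {i : ℕ} (hi : i < n) {x : ℝ} (hx : x ∈ Icc (cum p i) (cum p (i + 1))) :
    edgeParam p i x ∈ Icc (0 : ℝ) 1 := by
  rw [cum_succ hi] at hx
  exact ⟨div_nonneg (sub_nonneg.2 hx.1) dist_nonneg,
    div_le_one_of_le₀ (sub_le_iff_le_add'.2 hx.2) dist_nonneg⟩

namespace IsArcParam

theorem eq_lineMap (hA : IsArcParam p A) {i : ℕ} (hi : i < n) {x : ℝ}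
    (hx : x ∈ Icc (cum p i) (cum p (i + 1))) :
    A x = AffineMap.lineMap (pext p i) (pext p (i + 1)) (edgeParam p i x) := by
  rw [hA i hi x hx, AffineMap.lineMap_apply_module', add_comm, edgeParam]

theorem apply_zero (hA : IsArcParam p A) (hn : 0 < n) : A 0 = p 0 := by
  rw [hA 0 hn 0 ⟨cum_zero.le, cum_nonneg _⟩]
  simp [cum_zero, pext_zero]

theorem apply_cum_succ (hA : IsArcParam p A) {i : ℕ} (hi : i < n) :
    A (cum p (i + 1)) = pext p (i + 1) := by
  rw [hA i hi _ ⟨cum_le_cum_succ hi, le_rfl⟩, cum_succ hi, add_sub_cancel_left]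
  rcases eq_or_ne (pext p i) (pext p (i + 1)) with h | h
  · simp [h]
  · rw [div_self (dist_ne_zero.2 h), one_smul, add_sub_cancel]

theorem continuousOn (hA : IsArcParam p A) {i : ℕ} (hi : i ≤ n) :
    ContinuousOn A (Icc 0 (cum p i)) := by
  induction i with
  | zero => simp [cum_zero]
  | succ i ih =>
    rw [← Icc_union_Icc_eq_Icc (cum_nonneg i) (cum_le_cum_succ hi)]
    refine (ih (Nat.le_of_succ_le hi)).union_of_isClosed ?_ isClosed_Icc isClosed_Icc
    refine ContinuousOn.congr ?_ fun x hx => hA.eq_lineMap hi hx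
    exact (AffineMap.lineMap_continuous.comp (continuous_edgeParam i)).continuousOn

theorem mem_of_convex (hA : IsArcParam p A) {s : Set (EuclideanSpace ℝ (Fin d))}
    (hs : Convex ℝ s) (hn : 0 < n) {i : ℕ} (hi : i ≤ n) (hp : ∀ j ≤ i, pext p j ∈ s) {x : ℝ}
    (hx : x ∈ Icc 0 (cum p i)) : A x ∈ s := by
  induction i with
  | zero =>
    have : x = 0 := le_antisymm (hx.2.trans cum_zero.le) hx.1
    rw [this, hA.apply_zero hn, ← pext_zero (p := p)]
    exact hp 0 le_rfl
  | succ i ih =>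
    rcases le_total x (cum p i) with h | h
    · exact ih (Nat.le_of_succ_le hi) (fun j hj => hp j (Nat.le_succ_of_le hj)) ⟨hx.1, h⟩
    · rw [hA.eq_lineMap hi ⟨h, hx.2⟩]
      exact hs.lineMap_mem (hp i (Nat.le_succ i)) (hp _ le_rfl) (edgeParam_mem hi ⟨h, hx.2⟩)

end IsArcParam

end ArcLength

/-- If all vertices of a polygonal curve `A` except the last are within
distance `δ` of its first vertex, then the monotonized nearest-point projection of `A` onto
the segment `s` from its first to its last vertex is a morphing of width at most `2δ`;
consequently `d_F(A, s) ≤ 2δ`. -/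
theorem cluster_to_segment_morphing (d n : ℕ) (hn : 1 ≤ n) (δ : ℝ) (hδ : 0 < δ)
    (p : Fin (n + 1) → EuclideanSpace ℝ (Fin d))
    (hne : p 0 ≠ p (Fin.last n))
    (hclose : ∀ j : Fin (n + 1), j.val < n → dist (p j) (p 0) ≤ δ)
    (A : ℝ → EuclideanSpace ℝ (Fin d)) (hA : IsArcParam p A)
    (f : ℝ → ℝ)
    (hf : ∀ t ∈ Set.Icc (0 : ℝ) (cum p n),
      f t ∈ Set.Icc (0 : ℝ) (dist (p 0) (p (Fin.last n))) ∧
      ∀ y ∈ Set.Icc (0 : ℝ) (dist (p 0) (p (Fin.last n))),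
        dist (A t) (segParam (p 0) (p (Fin.last n)) (f t)) ≤
          dist (A t) (segParam (p 0) (p (Fin.last n)) y)) :
    runMax f 0 = 0 ∧
    runMax f (cum p n) = dist (p 0) (p (Fin.last n)) ∧
    (∀ t ∈ Set.Icc (0 : ℝ) (cum p n),
      dist (A t) (segParam (p 0) (p (Fin.last n)) (runMax f t)) ≤ 2 * δ) ∧
    frechetDist (fun u => A (u * cum p n))
      (fun u => segParam (p 0) (p (Fin.last n)) (u * dist (p 0) (p (Fin.last n)))) ≤
        2 * δ := by
  obtain ⟨m, rfl⟩ : ∃ m, n = m + 1 := ⟨n - 1, by omega⟩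
  have hm : m < m + 1 := Nat.lt_succ_self m
  set a := p 0
  set b := p (Fin.last (m + 1))
  set L := cum p (m + 1) with hL
  have hD : 0 < dist a b := dist_pos.2 hne
  have hL₀ : 0 ≤ L := cum_nonneg _
  have hq : dist (pext p m) a ≤ δ := hclose _ (by simp)
  have hlast : pext p (m + 1) = b := pext_self
  have hclamp : ∀ t ∈ Icc 0 L, f t = max 0 (min (dist a b) (axisCoord a b (A t))) :=
    fun t ht => nearest_eq_clamp hne (hf t ht).1 (hf t ht).2
  have hfcont : ContinuousOn f (Icc 0 L) := by
    refine ContinuousOn.congr ?_ hclamp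
    exact continuousOn_const.sup
      (continuousOn_const.inf (continuous_axisCoord.comp_continuousOn (hA.continuousOn le_rfl)))
  have hnear : ∀ t ∈ Icc 0 (cum p m), dist (A t) a ≤ δ := fun t ht =>
    hA.mem_of_convex (convex_closedBall a δ) m.succ_pos hm.le
      (fun j hj => hclose _ (by simp; omega)) ht
  have hedge : ∀ t ∈ Icc (cum p m) L, A t = AffineMap.lineMap (pext p m) b (edgeParam p m t) :=
    fun t ht => by rw [hA.eq_lineMap hm ht, hlast]
  have hproj : ∀ t ∈ Icc 0 L, dist (A t) (segParam a b (f t)) ≤ δ := by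
    intro t ht
    rcases le_total t (cum p m) with h | h
    · refine ((hf t ht).2 0 ⟨le_rfl, hD.le⟩).trans ?_
      rw [segParam_zero]
      exact hnear t ⟨ht.1, h⟩
    · obtain ⟨hc₀, hc₁⟩ := edgeParam_mem hm (⟨h, ht.2⟩ : t ∈ Icc (cum p m) (cum p (m + 1)))
      refine ((hf t ht).2 (edgeParam p m t * dist a b)
        ⟨mul_nonneg hc₀ hD.le, mul_le_of_le_one_left hD.le hc₁⟩).trans ?_
      rw [segParam_mul_dist hne, hedge t ⟨h, ht.2⟩, dist_eq_norm]
      have : AffineMap.lineMap (pext p m) b (edgeParam p m t) -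
          AffineMap.lineMap a b (edgeParam p m t) =
          (1 - edgeParam p m t) • (pext p m - a) := by
        simp only [AffineMap.lineMap_apply_module]
        module
      rw [this, norm_smul, ← dist_eq_norm (pext p m), Real.norm_of_nonneg (sub_nonneg.2 hc₁)]
      nlinarith [dist_nonneg (x := pext p m) (y := a)]
  have hback : ∀ τ t, 0 ≤ τ → τ ≤ t → t ≤ L → f τ ≤ f t + δ := by
    intro τ t hτ hτt ht
    have hft := (hf t ⟨hτ.trans hτt, ht⟩).1.1
    have hτL : τ ∈ Icc 0 L := ⟨hτ, hτt.trans ht⟩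
    rcases le_or_gt (f τ) δ with h | h
    · linarith
    have hfar : cum p m ≤ τ := by
      by_contra! hlt
      refine h.not_ge ?_
      rw [hclamp τ hτL]
      exact max_le hδ.le ((min_le_right _ _).trans
        ((axisCoord_le_dist _).trans (hnear τ ⟨hτ, hlt.le⟩)))
    have hDδ : δ < dist a b := h.trans_le (hf τ hτL).1.2
    have hle : f τ ≤ f t := by
      rw [hclamp τ hτL, hclamp t ⟨hτ.trans hτt, ht⟩]
      refine max_le_max le_rfl (min_le_min le_rfl ?_)
      rw [hedge τ ⟨hfar, hτL.2⟩, hedge t ⟨hfar.trans hτt, ht⟩, axisCoord_lineMap,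
        axisCoord_lineMap, axisCoord_right]
      have hqD : axisCoord a b (pext p m) ≤ dist a b :=
        (axisCoord_le_dist _).trans (hq.trans hDδ.le)
      have := mul_le_mul_of_nonneg_right (edgeParam_mono (p := p) m hτt) (sub_nonneg.2 hqD)
      linarith
    linarith
  have h₀ : runMax f 0 = 0 := by
    rw [runMax_zero, hclamp 0 ⟨le_rfl, hL₀⟩, hA.apply_zero m.succ_pos, axisCoord_left,
      min_eq_right hD.le, max_self]
  have h₁ : runMax f L = dist a b := by
    refine le_antisymm (runMax_le hL₀ fun τ hτ => (hf τ hτ).1.2) ?_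
    have hfL : f L = dist a b := by
      rw [hclamp L ⟨hL₀, le_rfl⟩, hL, hA.apply_cum_succ hm, hlast, axisCoord_right, min_self,
        max_eq_right hD.le]
    exact hfL.symm.le.trans (le_runMax hfcont hL₀ le_rfl le_rfl)
  have hwidth : ∀ t ∈ Icc 0 L, dist (A t) (segParam a b (runMax f t)) ≤ 2 * δ := by
    intro t ht
    have hup : runMax f t ≤ f t + δ :=
      runMax_le ht.1 fun τ hτ => hback τ t hτ.1 hτ.2 ht.2
    have hlow : f t ≤ runMax f t := le_runMax hfcont ht.1 le_rfl ht.2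
    calc dist (A t) (segParam a b (runMax f t))
        ≤ dist (A t) (segParam a b (f t)) +
          dist (segParam a b (f t)) (segParam a b (runMax f t)) := dist_triangle _ _ _
      _ ≤ δ + δ := by
        refine add_le_add (hproj t ht) ?_
        rw [dist_segParam_segParam hne, abs_le]
        constructor <;> linarith
      _ = 2 * δ := by ring
  refine ⟨h₀, h₁, hwidth, frechetDist_le reparam_id (reparam_runMax hL₀ hD hfcont h₀ h₁) ?_⟩
  intro u hu
  have := hwidth (u * L) ⟨mul_nonneg hu.1 hL₀, mul_le_of_le_one_left hL₀ hu.2⟩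
  rwa [div_mul_cancel₀ _ hD.ne', ← dist_eq_norm]
end
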